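/- Consider fictitious play in a finite extensive-form game G of perfect recall in which all players have a common payoff u : Z → ℝ. Along any infinite play-path with empirical frequencies {f_t}, for every information set h ∈ H that is visited infinitely many times one has Σ_{k∈ℕ} V_{f_{t_k(h)}}(h)/k < ∞, where t_k(h) denotes the round in which h is visited for the k-th time. -/

import Mathlib

open Classical Filter MeasureTheory
open scoped BigOperators

noncomputable section

/-- A finite extensive-form game (no chance moves): a finite rooted tree with
decision and terminal nodes, moves, information sets and players. -/
structure ExtGame where
  Node : Type
  Move : Type
  Info : Type
  Player : Type
  nodeFintype : Fintype Node
  nodeDecEq : DecidableEq Node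
  moveFintype : Fintype Move
  moveDecEq : DecidableEq Move
  infoFintype : Fintype Info
  infoDecEq : DecidableEq Info
  playerFintype : Fintype Player
  playerDecEq : DecidableEq Player
  root : Node
  /-- the immediate predecessor of a node together with the move leading from it;
  `none` exactly at the root -/
  parentMove : Node → Option (Node × Move)
  /-- depth of a node in the tree (ensures acyclicity) -/
  rank : Node → ℕ
  parentMove_root : parentMove root = none
  eq_root_of_parentMove_eq_none : ∀ n, parentMove n = none → n = root
  rank_succ : ∀ n m a, parentMove n = some (m, a) → rank n = rank m + 1
  /-- decision nodes; the remaining nodes are terminal -/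
  decision : Node → Prop
  /-- the information set containing a (decision) node -/
  info : Node → Info
  /-- the player moving at an information set -/
  player : Info → Player
  /-- the set of moves available at an information set -/
  avail : Info → Finset Move
  avail_nonempty : ∀ h, (avail h).Nonempty
  /-- moves are in bijection with immediate successors -/
  child_exists : ∀ n, decision n → ∀ a ∈ avail (info n), ∃! n', parentMove n' = some (n, a)
  parent_decision : ∀ n' n a, parentMove n' = some (n, a) → decision n ∧ a ∈ avail (info n)
  /-- information sets partition the set of decision nodes -/
  info_surjOn_decision : ∀ h, ∃ n, decision n ∧ info n = h
  root_decision : decision root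
  /-- the information set of the root is the singleton {root} -/
  root_info_singleton : ∀ n, decision n → info n = info root → n = root
  exists_terminal : ∃ n, ¬ decision n

namespace ExtGame

variable (G : ExtGame)

instance : Fintype G.Node := G.nodeFintype
instance : DecidableEq G.Node := G.nodeDecEq
instance : Fintype G.Move := G.moveFintype
instance : DecidableEq G.Move := G.moveDecEq
instance : Fintype G.Info := G.infoFintype
instance : DecidableEq G.Info := G.infoDecEq
instance : Fintype G.Player := G.playerFintype
instance : DecidableEq G.Player := G.playerDecEq

/-- auxiliary, fuel-based computation of the list of (information set, move) pairs
crossed on the unique path from the root to a node -/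
def pathAux : ℕ → G.Node → List (G.Info × G.Move)
  | 0, _ => []
  | fuel + 1, n =>
    match G.parentMove n with
    | none => []
    | some (m, a) => pathAux fuel m ++ [(G.info m, a)]

/-- the list of (information set, move) pairs crossed on the unique path from the
root to a node; since `rank` increases by exactly one along each edge, the fuel
`G.rank n` is always sufficient -/
def pathPairs (n : G.Node) : List (G.Info × G.Move) := G.pathAux (G.rank n) n

/-- `(h, a) ⊑ n` : the path from the root to `n` goes through `h`, taking move `a` -/
def chooses (h : G.Info) (a : G.Move) (n : G.Node) : Prop := (h, a) ∈ G.pathPairs n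

/-- `h ⊑ n` : the path from the root to `n` goes through the information set `h` -/
def visits (h : G.Info) (n : G.Node) : Prop := ∃ a, G.chooses h a n

/-- terminal nodes -/
def terminalSet : Finset G.Node := Finset.univ.filter fun n => ¬ G.decision n

/-- a behavioral strategy profile: a probability distribution on `avail h` for each
information set `h` -/
def IsProfile (g : G.Info → G.Move → ℝ) : Prop :=
  (∀ h a, 0 ≤ g h a) ∧ (∀ h, ∑ a ∈ G.avail h, g h a = 1) ∧ ∀ h a, a ∉ G.avail h → g h a = 0

/-- probability of reaching node `n` under profile `g` -/
def reachProb (g : G.Info → G.Move → ℝ) (n : G.Node) : ℝ :=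
  ((G.pathPairs n).map fun p => g p.1 p.2).prod

/-- expected payoff (for payoff function `u` on terminal nodes) under profile `g` -/
def eu (u : G.Node → ℝ) (g : G.Info → G.Move → ℝ) : ℝ :=
  ∑ z ∈ G.terminalSet, u z * G.reachProb g z

/-- `(a, g^{-h})` : the profile `g` with `g (·|h)` replaced by the point mass at `a` -/
def replace (g : G.Info → G.Move → ℝ) (h : G.Info) (a : G.Move) : G.Info → G.Move → ℝ :=
  fun h' b => if h' = h then (if b = a then 1 else 0) else g h' b

/-- `max_{a ∈ A^h} u(a, g^{-h})` -/
def brMax (u : G.Node → ℝ) (g : G.Info → G.Move → ℝ) (h : G.Info) : ℝ :=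
  ((G.avail h).image fun a => G.eu u (G.replace g h a)).max' ((G.avail_nonempty h).image _)

/-- the move `a` is a (local) best reply at `h` against `g` -/
def IsBR (u : G.Node → ℝ) (g : G.Info → G.Move → ℝ) (h : G.Info) (a : G.Move) : Prop :=
  a ∈ G.avail h ∧ G.eu u (G.replace g h a) = G.brMax u g h

/-- the optimality gap `V_g(h)` of the profile `g` at the information set `h`,
for the payoff function `u` of the player moving at `h` -/
def gap (u : G.Node → ℝ) (g : G.Info → G.Move → ℝ) (h : G.Info) : ℝ :=
  G.brMax u g h - G.eu u g

/-- the experience of player `i` on the path to a node: the information sets of `i`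
crossed and the moves taken there -/
def experience (i : G.Player) (n : G.Node) : List (G.Info × G.Move) :=
  (G.pathPairs n).filter fun p => G.player p.1 = i

/-- perfect recall: two nodes in the same information set give its player identical
experiences -/
def PerfectRecall : Prop :=
  ∀ n m : G.Node, G.decision n → G.decision m → G.info n = G.info m →
    G.experience (G.player (G.info n)) n = G.experience (G.player (G.info n)) m

/-- indicator `I_t(h)` that the information set `h` is visited on the path to `n` -/
def visitInd (h : G.Info) (n : G.Node) : ℝ := if G.visits h n then 1 else 0

/-- indicator `I_t(a)` that the move `a` is chosen at `h` on the path to `n` -/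
def chooseInd (h : G.Info) (a : G.Move) (n : G.Node) : ℝ := if G.chooses h a n then 1 else 0

/-- `#_t(h)` : the number of rounds `1,…,t` in which `h` is visited -/
def visitCount (z : ℕ → G.Node) (t : ℕ) (h : G.Info) : ℝ :=
  ∑ k ∈ Finset.Icc 1 t, G.visitInd h (z k)

/-- The fictitious play process: in round `t = 1,2,…` the play path reaches the
terminal node `z t`; `f t` are the empirical frequencies entering round `t`;
every move made on the realized path is a local best reply against `f t`. -/
structure IsFP (payoff : G.Player → G.Node → ℝ) (f : ℕ → G.Info → G.Move → ℝ)
    (z : ℕ → G.Node) : Prop where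
  profile : ∀ t, 1 ≤ t → G.IsProfile (f t)
  terminal : ∀ t, 1 ≤ t → ¬ G.decision (z t)
  update : ∀ t, 1 ≤ t → ∀ h a,
    f (t + 1) h a = f t h a +
      G.visitInd h (z t) / G.visitCount z t h * (G.chooseInd h a (z t) - f t h a)
  bestReply : ∀ t, 1 ≤ t → ∀ h a, G.chooses h a (z t) →
    G.eu (payoff (G.player h)) (G.replace (f t) h a) = G.brMax (payoff (G.player h)) (f t) h

end ExtGame

open ExtGame

namespace ExtGame

variable {G : ExtGame}

lemma pathPairs_of_parentMove_none {n : G.Node} (hn : G.parentMove n = none) :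
    G.pathPairs n = [] := by
  unfold pathPairs
  cases G.rank n <;> simp [pathAux, hn]

lemma pathPairs_of_parentMove_some {n m : G.Node} {a : G.Move}
    (hn : G.parentMove n = some (m, a)) :
    G.pathPairs n = G.pathPairs m ++ [(G.info m, a)] := by
  unfold pathPairs
  rw [G.rank_succ n m a hn]
  simp [pathAux, hn]

/-- Induction along the edges of the game tree. -/
lemma node_induction {P : G.Node → Prop} (root : ∀ n, G.parentMove n = none → P n)
    (step : ∀ n m a, G.parentMove n = some (m, a) → P m → P n) (n : G.Node) : P n := by
  induction hr : G.rank n using Nat.strong_induction_on generalizing n with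
  | _ r ih =>
    rcases hp : G.parentMove n with _ | ⟨m, a⟩
    · exact root n hp
    · exact step n m a hp (ih _ (by have := G.rank_succ n m a hp; omega) m rfl)

lemma exists_sublist_of_mem_pathPairs (n : G.Node) :
    ∀ p ∈ G.pathPairs n, ∃ m, G.decision m ∧ G.info m = p.1 ∧ p.2 ∈ G.avail p.1 ∧
      (G.pathPairs m ++ [p]).Sublist (G.pathPairs n) := by
  induction n using node_induction with
  | root n hn => simp [pathPairs_of_parentMove_none hn]
  | step n m a hn ih =>
    intro p hp
    rw [pathPairs_of_parentMove_some hn] at hp ⊢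
    rcases List.mem_append.1 hp with hp | hp
    · obtain ⟨m', h1, h2, h3, h4⟩ := ih p hp
      exact ⟨m', h1, h2, h3, h4.trans (List.sublist_append_left _ _)⟩
    · obtain rfl := List.mem_singleton.1 hp
      obtain ⟨hd, ha⟩ := G.parent_decision n m a hn
      exact ⟨m, hd, rfl, ha, List.Sublist.refl _⟩

lemma chooses.mem_avail {h : G.Info} {a : G.Move} {n : G.Node} (hc : G.chooses h a n) :
    a ∈ G.avail h := by
  obtain ⟨_, _, _, ha, _⟩ := exists_sublist_of_mem_pathPairs n _ hc
  exact ha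

lemma PerfectRecall.nodup_map_fst_pathPairs (hPR : G.PerfectRecall) (n : G.Node) :
    ((G.pathPairs n).map Prod.fst).Nodup := by
  induction n using node_induction with
  | root n hn => simp [pathPairs_of_parentMove_none hn]
  | step n m a hn ih =>
    rw [pathPairs_of_parentMove_some hn, List.map_append, List.map_singleton,
      List.nodup_append']
    refine ⟨ih, List.nodup_singleton _, List.disjoint_singleton.2 fun hmem => ?_⟩
    obtain ⟨p, hp, hpm⟩ := List.mem_map.1 hmem
    obtain ⟨m', hd', hi', _, hs⟩ := exists_sublist_of_mem_pathPairs m p hp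
    have hexp := hPR m m' (G.parent_decision n m a hn).1 hd' (by rw [hi', hpm])
    have hlen := (hs.filter fun q => G.player q.1 = G.player (G.info m)).length_le
    unfold experience at hexp
    simp [hexp, hpm] at hlen

lemma PerfectRecall.chooses_unique (hPR : G.PerfectRecall) {h : G.Info} {a b : G.Move}
    {n : G.Node} (ha : G.chooses h a n) (hb : G.chooses h b n) : a = b :=
  congrArg Prod.snd
    (List.inj_on_of_nodup_map (hPR.nodup_map_fst_pathPairs n) ha hb rfl : (h, a) = (h, b))

/-- The factor that the local strategy `q` at `h` contributes to the reach probability of `n`. -/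
def factor (h : G.Info) (n : G.Node) (q : G.Move → ℝ) : ℝ :=
  if hv : G.visits h n then q hv.choose else 1

lemma factor_of_chooses (hPR : G.PerfectRecall) {h : G.Info} {a : G.Move} {n : G.Node}
    (ha : G.chooses h a n) (q : G.Move → ℝ) : factor h n q = q a := by
  have hv : G.visits h n := ⟨a, ha⟩
  rw [factor, dif_pos hv, hPR.chooses_unique hv.choose_spec ha]

lemma PerfectRecall.reachProb_eq_prod (hPR : G.PerfectRecall) (g : G.Info → G.Move → ℝ)
    (n : G.Node) : G.reachProb g n = ∏ h, factor h n (g h) := by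
  have hnd := hPR.nodup_map_fst_pathPairs n
  have hinj : Set.InjOn Prod.fst ((G.pathPairs n).toFinset : Set (G.Info × G.Move)) := by
    intro p hp q hq hpq
    exact List.inj_on_of_nodup_map hnd (by simpa using hp) (by simpa using hq) hpq
  calc G.reachProb g n
      = ∏ p ∈ (G.pathPairs n).toFinset, g p.1 p.2 := (List.prod_toFinset _ hnd.of_map).symm
    _ = ∏ p ∈ (G.pathPairs n).toFinset, factor p.1 n (g p.1) := by
        refine Finset.prod_congr rfl fun p hp => ?_
        exact (factor_of_chooses hPR (List.mem_toFinset.1 hp : G.chooses p.1 p.2 n) _).symm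
    _ = ∏ h ∈ (G.pathPairs n).toFinset.image Prod.fst, factor h n (g h) :=
        (Finset.prod_image (f := fun h => factor h n (g h)) hinj).symm
    _ = ∏ h, factor h n (g h) := by
        refine Finset.prod_subset (Finset.subset_univ _) fun h _ hh => ?_
        refine dif_neg ?_
        rintro ⟨a, ha⟩
        exact hh (Finset.mem_image.2 ⟨(h, a), List.mem_toFinset.2 ha, rfl⟩)

/-- The local strategy choosing `a` with certainty. -/
def pureMove (a : G.Move) : G.Move → ℝ := fun b => if b = a then 1 else 0

lemma PerfectRecall.reachProb_replace (hPR : G.PerfectRecall) (g : G.Info → G.Move → ℝ)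
    (h : G.Info) (a : G.Move) (n : G.Node) :
    G.reachProb (G.replace g h a) n =
      factor h n (pureMove a) * ∏ h' ∈ Finset.univ.erase h, factor h' n (g h') := by
  rw [hPR.reachProb_eq_prod, ← Finset.mul_prod_erase _ _ (Finset.mem_univ h)]
  congr 1
  · congr 1
    funext b
    simp [replace, pureMove]
  · refine Finset.prod_congr rfl fun h' hh' => ?_
    congr 1
    funext b
    simp [replace, Finset.ne_of_mem_erase hh']

lemma IsProfile.le_one {g : G.Info → G.Move → ℝ} (hg : G.IsProfile g) (h : G.Info)
    (a : G.Move) : g h a ≤ 1 := by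
  by_cases ha : a ∈ G.avail h
  · rw [← hg.2.1 h]
    exact Finset.single_le_sum (f := g h) (fun b _ => hg.1 h b) ha
  · rw [hg.2.2 h a ha]
    exact zero_le_one

lemma IsProfile.factor_mem_Icc {g : G.Info → G.Move → ℝ} (hg : G.IsProfile g) (h : G.Info)
    (n : G.Node) : factor h n (g h) ∈ Set.Icc (0 : ℝ) 1 := by
  unfold factor
  split_ifs with hv
  · exact ⟨hg.1 h _, hg.le_one h _⟩
  · simp

lemma IsProfile.sum_mul_factor_pureMove {g : G.Info → G.Move → ℝ} (hg : G.IsProfile g)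
    (h : G.Info) (n : G.Node) :
    ∑ a ∈ G.avail h, g h a * factor h n (pureMove a) = factor h n (g h) := by
  unfold factor
  split_ifs with hv
  · simp only [pureMove, mul_ite, mul_one, mul_zero, Finset.sum_ite_eq]
    split_ifs with ha
    · rfl
    · exact (hg.2.2 h _ ha).symm
  · simpa using hg.2.1 h

lemma IsProfile.eu_eq_sum_replace (hPR : G.PerfectRecall) {g : G.Info → G.Move → ℝ}
    (hg : G.IsProfile g) (u : G.Node → ℝ) (h : G.Info) :
    G.eu u g = ∑ a ∈ G.avail h, g h a * G.eu u (G.replace g h a) := by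
  simp only [eu, Finset.mul_sum]
  rw [Finset.sum_comm]
  refine Finset.sum_congr rfl fun n _ => ?_
  rw [hPR.reachProb_eq_prod, ← Finset.mul_prod_erase _ _ (Finset.mem_univ h),
    ← hg.sum_mul_factor_pureMove h n, Finset.sum_mul, Finset.mul_sum]
  refine Finset.sum_congr rfl fun a _ => ?_
  rw [hPR.reachProb_replace]
  ring

lemma eu_replace_le_brMax (u : G.Node → ℝ) (g : G.Info → G.Move → ℝ) {h : G.Info}
    {a : G.Move} (ha : a ∈ G.avail h) : G.eu u (G.replace g h a) ≤ G.brMax u g h :=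
  Finset.le_max' _ _ (Finset.mem_image_of_mem (fun a => G.eu u (G.replace g h a)) ha)

lemma IsProfile.gap_nonneg (hPR : G.PerfectRecall) {g : G.Info → G.Move → ℝ}
    (hg : G.IsProfile g) (u : G.Node → ℝ) (h : G.Info) : 0 ≤ G.gap u g h := by
  rw [gap, sub_nonneg, hg.eu_eq_sum_replace hPR u h]
  calc ∑ a ∈ G.avail h, g h a * G.eu u (G.replace g h a)
      ≤ ∑ a ∈ G.avail h, g h a * G.brMax u g h :=
        Finset.sum_le_sum fun a ha =>
          mul_le_mul_of_nonneg_left (eu_replace_le_brMax u g ha) (hg.1 h a)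
    _ = G.brMax u g h := by rw [← Finset.sum_mul, hg.2.1 h, one_mul]

lemma IsProfile.abs_eu_le (hPR : G.PerfectRecall) {g : G.Info → G.Move → ℝ}
    (hg : G.IsProfile g) (u : G.Node → ℝ) : |G.eu u g| ≤ ∑ n ∈ G.terminalSet, |u n| := by
  refine (Finset.abs_sum_le_sum_abs _ _).trans (Finset.sum_le_sum fun n _ => ?_)
  have h0 : 0 ≤ G.reachProb g n := by
    rw [hPR.reachProb_eq_prod]
    exact Finset.prod_nonneg fun h _ => (hg.factor_mem_Icc h n).1
  have h1 : G.reachProb g n ≤ 1 := by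
    rw [hPR.reachProb_eq_prod]
    exact Finset.prod_le_one (fun h _ => (hg.factor_mem_Icc h n).1)
      fun h _ => (hg.factor_mem_Icc h n).2
  rw [abs_mul, abs_of_nonneg h0]
  exact mul_le_of_le_one_right (abs_nonneg _) h1

end ExtGame

/-- First-order expansion of a product of numbers in `[0, 1]`, with quadratic error. -/
lemma abs_prod_sub_prod_sub_linear_le {ι : Type*} [DecidableEq ι] (s : Finset ι) (x y : ι → ℝ)
    (hx : ∀ i, x i ∈ Set.Icc (0 : ℝ) 1) (hy : ∀ i, y i ∈ Set.Icc (0 : ℝ) 1) :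
    |∏ i ∈ s, y i - ∏ i ∈ s, x i| ≤ ∑ i ∈ s, |y i - x i| ∧
    |∏ i ∈ s, y i - ∏ i ∈ s, x i - ∑ i ∈ s, (y i - x i) * ∏ j ∈ s.erase i, x j| ≤
      (∑ i ∈ s, |y i - x i|) ^ 2 := by
  induction s using Finset.induction_on with
  | empty => simp
  | insert a s ha ih =>
    obtain ⟨ih1, ih2⟩ := ih
    have hlin : ∑ i ∈ insert a s, (y i - x i) * ∏ j ∈ (insert a s).erase i, x j =
        (y a - x a) * ∏ j ∈ s, x j + x a * ∑ i ∈ s, (y i - x i) * ∏ j ∈ s.erase i, x j := by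
      rw [Finset.sum_insert ha, Finset.erase_insert ha, Finset.mul_sum]
      congr 1
      refine Finset.sum_congr rfl fun i hi => ?_
      have hia : a ≠ i := fun h => ha (h ▸ hi)
      rw [Finset.erase_insert_of_ne hia,
        Finset.prod_insert (fun h => ha (Finset.mem_of_mem_erase h))]
      ring
    rw [hlin, Finset.prod_insert ha, Finset.prod_insert ha, Finset.sum_insert ha]
    set X := ∏ i ∈ s, x i
    set Y := ∏ i ∈ s, y i
    set L := ∑ i ∈ s, (y i - x i) * ∏ j ∈ s.erase i, x j
    set E := ∑ i ∈ s, |y i - x i|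
    have hX0 : 0 ≤ X := Finset.prod_nonneg fun i _ => (hx i).1
    have hX1 : X ≤ 1 := Finset.prod_le_one (fun i _ => (hx i).1) fun i _ => (hx i).2
    have hE : 0 ≤ E := Finset.sum_nonneg fun i _ => abs_nonneg _
    have he := abs_nonneg (y a - x a)
    constructor
    · have h1 : y a * Y - x a * X = y a * (Y - X) + (y a - x a) * X := by ring
      rw [h1]
      refine (abs_add_le _ _).trans ?_
      rw [abs_mul, abs_mul, abs_of_nonneg (hy a).1, abs_of_nonneg hX0]
      nlinarith [mul_le_of_le_one_left (abs_nonneg (Y - X)) (hy a).2,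
        mul_le_of_le_one_right he hX1]
    · have h1 : y a * Y - x a * X - ((y a - x a) * X + x a * L) =
          (y a - x a) * (Y - X) + x a * (Y - X - L) := by ring
      rw [h1]
      refine (abs_add_le _ _).trans ?_
      rw [abs_mul, abs_mul, abs_of_nonneg (hx a).1]
      nlinarith [mul_le_of_le_one_left (abs_nonneg (Y - X - L)) (hx a).2,
        mul_le_mul_of_nonneg_left ih1 he, mul_nonneg he hE, sq_nonneg |y a - x a|]

namespace ExtGame

variable {G : ExtGame}

/-- First-order lower bound for the change of the expected payoff when the local strategy at each
information set `h` moves by the fraction `c h` towards the pure move `b h`. -/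
lemma IsProfile.eu_sub_eu_ge (hPR : G.PerfectRecall) {g g' : G.Info → G.Move → ℝ}
    (hg : G.IsProfile g) (hg' : G.IsProfile g') (u : G.Node → ℝ) (c : G.Info → ℝ)
    (hc : ∀ h, 0 ≤ c h) (b : G.Info → G.Move)
    (hupd : ∀ h a, g' h a = g h a + c h * (pureMove (b h) a - g h a)) :
    ∑ h, c h * (G.eu u (G.replace g h (b h)) - G.eu u g) -
        (∑ n ∈ G.terminalSet, |u n|) * (∑ h, c h) ^ 2 ≤
      G.eu u g' - G.eu u g := by
  have hdiff : ∀ h n, factor h n (g' h) - factor h n (g h) =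
      c h * (factor h n (pureMove (b h)) - factor h n (g h)) := by
    intro h n
    unfold factor
    split_ifs
    · rw [hupd]; ring
    · ring
  have habs : ∀ h n, |factor h n (g' h) - factor h n (g h)| ≤ c h := by
    intro h n
    rw [hdiff, abs_mul, abs_of_nonneg (hc h)]
    refine mul_le_of_le_one_right (hc h) ?_
    have h1 := hg.factor_mem_Icc h n
    have h2 : factor h n (pureMove (b h)) ∈ Set.Icc (0 : ℝ) 1 := by
      unfold factor pureMove
      split_ifs <;> simp
    rw [abs_le]
    constructor <;> linarith [h1.1, h1.2, h2.1, h2.2]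
  have hnode : ∀ n, |G.reachProb g' n - G.reachProb g n -
      ∑ h, c h * (G.reachProb (G.replace g h (b h)) n - G.reachProb g n)| ≤ (∑ h, c h) ^ 2 := by
    intro n
    have key := (abs_prod_sub_prod_sub_linear_le Finset.univ (fun h => factor h n (g h))
      (fun h => factor h n (g' h)) (fun h => hg.factor_mem_Icc h n)
      (fun h => hg'.factor_mem_Icc h n)).2
    have hlin : ∀ h, c h * (G.reachProb (G.replace g h (b h)) n - G.reachProb g n) =
        (factor h n (g' h) - factor h n (g h)) *
          ∏ h' ∈ Finset.univ.erase h, factor h' n (g h') := by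
      intro h
      rw [hdiff, hPR.reachProb_replace, hPR.reachProb_eq_prod,
        ← Finset.mul_prod_erase _ _ (Finset.mem_univ h)]
      ring
    simp only [hlin]
    rw [hPR.reachProb_eq_prod, hPR.reachProb_eq_prod]
    refine key.trans (pow_le_pow_left₀ (Finset.sum_nonneg fun _ _ => abs_nonneg _) ?_ 2)
    exact Finset.sum_le_sum fun h _ => habs h n
  have hsum : G.eu u g' - G.eu u g - ∑ h, c h * (G.eu u (G.replace g h (b h)) - G.eu u g) =
      ∑ n ∈ G.terminalSet, u n * (G.reachProb g' n - G.reachProb g n -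
        ∑ h, c h * (G.reachProb (G.replace g h (b h)) n - G.reachProb g n)) := by
    simp only [eu, mul_sub, Finset.sum_sub_distrib, Finset.mul_sum]
    rw [Finset.sum_comm (s := Finset.univ), Finset.sum_comm (s := Finset.univ)]
    congr 2 <;> refine Finset.sum_congr rfl fun _ _ => Finset.sum_congr rfl fun _ _ => by ring
  have hbound := Finset.abs_sum_le_sum_abs (fun n => u n * (G.reachProb g' n - G.reachProb g n -
        ∑ h, c h * (G.reachProb (G.replace g h (b h)) n - G.reachProb g n))) G.terminalSet
  rw [← hsum] at hbound
  have hbound' : ∑ n ∈ G.terminalSet, |u n * (G.reachProb g' n - G.reachProb g n -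
        ∑ h, c h * (G.reachProb (G.replace g h (b h)) n - G.reachProb g n))| ≤
      (∑ n ∈ G.terminalSet, |u n|) * (∑ h, c h) ^ 2 := by
    rw [Finset.sum_mul]
    refine Finset.sum_le_sum fun n _ => ?_
    rw [abs_mul]
    exact mul_le_mul_of_nonneg_left (hnode n) (abs_nonneg _)
  linarith [(abs_le.1 (hbound.trans hbound')).1]

/-- The step size of the empirical frequency at `h` in round `t`. -/
def stepSize (z : ℕ → G.Node) (t : ℕ) (h : G.Info) : ℝ :=
  G.visitInd h (z t) / G.visitCount z t h

lemma visitInd_nonneg (h : G.Info) (n : G.Node) : 0 ≤ G.visitInd h n := by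
  unfold visitInd
  split_ifs <;> simp

lemma visitCount_nonneg (z : ℕ → G.Node) (t : ℕ) (h : G.Info) : 0 ≤ G.visitCount z t h :=
  Finset.sum_nonneg fun _ _ => visitInd_nonneg _ _

lemma stepSize_nonneg (z : ℕ → G.Node) (t : ℕ) (h : G.Info) : 0 ≤ stepSize z t h :=
  div_nonneg (visitInd_nonneg _ _) (visitCount_nonneg _ _ _)

lemma stepSize_zero (z : ℕ → G.Node) (h : G.Info) : stepSize z 0 h = 0 := by
  simp [stepSize, visitCount]

lemma visitCount_succ (z : ℕ → G.Node) (t : ℕ) (h : G.Info) :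
    G.visitCount z (t + 1) h = G.visitCount z t h + G.visitInd h (z (t + 1)) :=
  Finset.sum_Icc_succ_top (by omega) _

lemma sum_stepSize_sq_le (z : ℕ → G.Node) (h : G.Info) (T : ℕ) :
    ∑ t ∈ Finset.range T, stepSize z (t + 1) h ^ 2 ≤ 2 - 2 / (G.visitCount z T h + 1) := by
  induction T with
  | zero => simp [visitCount]
  | succ T ih =>
    rw [Finset.sum_range_succ]
    refine (add_le_add_left ih _).trans ?_
    have hN := visitCount_nonneg z T h
    rw [stepSize, visitCount_succ]
    by_cases hv : G.visits h (z (T + 1))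
    · rw [show G.visitInd h (z (T + 1)) = 1 from if_pos hv]
      set N := G.visitCount z T h
      have h1 : 2 / (N + 1) - 2 / (N + 1 + 1) - (1 / (N + 1)) ^ 2 =
          N / ((N + 1) ^ 2 * (N + 2)) := by
        field_simp
        ring
      have h2 : 0 ≤ N / ((N + 1) ^ 2 * (N + 2)) := by positivity
      linarith
    · simp [show G.visitInd h (z (T + 1)) = 0 from if_neg hv]

/-- In round `t` of fictitious play with common payoff `u`, the expected payoff grows by at least
the weighted sum of the optimality gaps, up to a second-order error. -/
lemma IsFP.sum_stepSize_mul_gap_le (hPR : G.PerfectRecall) {u : G.Node → ℝ}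
    {f : ℕ → G.Info → G.Move → ℝ} {z : ℕ → G.Node} (hFP : G.IsFP (fun _ => u) f z) {t : ℕ}
    (ht : 1 ≤ t) :
    ∑ h, stepSize z t h * G.gap u (f t) h ≤ G.eu u (f (t + 1)) - G.eu u (f t) +
      (∑ n ∈ G.terminalSet, |u n|) * (∑ h, stepSize z t h) ^ 2 := by
  have hb : ∀ h, ∃ b, G.visits h (z t) → G.chooses h b (z t) := fun h => by
    by_cases hv : G.visits h (z t)
    · exact ⟨hv.choose, fun _ => hv.choose_spec⟩
    · exact ⟨(G.avail_nonempty h).choose, fun h' => absurd h' hv⟩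
  choose b hb using hb
  have key := (hFP.profile t ht).eu_sub_eu_ge hPR (hFP.profile (t + 1) (by omega)) u
    (stepSize z t) (stepSize_nonneg z t) b (fun h a => by
      rw [hFP.update t ht h a, stepSize]
      by_cases hv : G.visits h (z t)
      · have : G.chooseInd h a (z t) = pureMove (b h) a := by
          unfold chooseInd pureMove
          have : G.chooses h a (z t) ↔ a = b h :=
            ⟨fun ha => hPR.chooses_unique ha (hb h hv), fun ha => ha ▸ hb h hv⟩
          simp only [this]
        rw [this]
      · simp [visitInd, hv])
  have heq : ∀ h, stepSize z t h * G.gap u (f t) h =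
      stepSize z t h * (G.eu u (G.replace (f t) h (b h)) - G.eu u (f t)) := by
    intro h
    by_cases hv : G.visits h (z t)
    · rw [gap, ← hFP.bestReply t ht h (b h) (hb h hv)]
    · simp [stepSize, visitInd, hv]
  simp only [heq]
  linarith

lemma IsFP.summable_stepSize_mul_gap (hPR : G.PerfectRecall) {u : G.Node → ℝ}
    {f : ℕ → G.Info → G.Move → ℝ} {z : ℕ → G.Node} (hFP : G.IsFP (fun _ => u) f z)
    (h : G.Info) : Summable fun t => stepSize z t h * G.gap u (f t) h := by
  rw [← summable_nat_add_iff 1]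
  set U := ∑ n ∈ G.terminalSet, |u n|
  have hU : 0 ≤ U := Finset.sum_nonneg fun _ _ => abs_nonneg _
  set K : ℝ := ((Finset.univ : Finset G.Info).card : ℝ)
  have hK : 0 ≤ K := Nat.cast_nonneg _
  have hnn : ∀ t h, 0 ≤ stepSize z (t + 1) h * G.gap u (f (t + 1)) h := fun t h =>
    mul_nonneg (stepSize_nonneg _ _ _) ((hFP.profile (t + 1) (by omega)).gap_nonneg hPR u h)
  refine summable_of_sum_range_le (c := 2 * U + U * (K * (K * 2))) (fun t => hnn t h) fun T => ?_
  have hsq : ∑ t ∈ Finset.range T, (∑ h, stepSize z (t + 1) h) ^ 2 ≤ K * (K * 2) := by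
    calc ∑ t ∈ Finset.range T, (∑ h, stepSize z (t + 1) h) ^ 2
        ≤ ∑ t ∈ Finset.range T, K * ∑ h, stepSize z (t + 1) h ^ 2 :=
          Finset.sum_le_sum fun t _ => sq_sum_le_card_mul_sum_sq
      _ = K * ∑ h, ∑ t ∈ Finset.range T, stepSize z (t + 1) h ^ 2 := by
          rw [← Finset.mul_sum, Finset.sum_comm]
      _ ≤ K * ∑ _h : G.Info, 2 := by
          refine mul_le_mul_of_nonneg_left (Finset.sum_le_sum fun h _ => ?_) hK
          have h1 := sum_stepSize_sq_le z h T
          have h2 : 0 ≤ 2 / (G.visitCount z T h + 1) :=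
            div_nonneg zero_le_two (by linarith [visitCount_nonneg z T h])
          linarith
      _ = K * (K * 2) := by rw [Finset.sum_const, nsmul_eq_mul]
  calc ∑ t ∈ Finset.range T, stepSize z (t + 1) h * G.gap u (f (t + 1)) h
      ≤ ∑ t ∈ Finset.range T, (G.eu u (f (t + 1 + 1)) - G.eu u (f (t + 1)) +
          U * (∑ h, stepSize z (t + 1) h) ^ 2) := by
        refine Finset.sum_le_sum fun t _ => ?_
        exact (Finset.single_le_sum (f := fun h => stepSize z (t + 1) h * G.gap u (f (t + 1)) h)
          (fun h _ => hnn t h) (Finset.mem_univ h)).trans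
            (hFP.sum_stepSize_mul_gap_le hPR (by omega))
    _ = G.eu u (f (T + 1)) - G.eu u (f 1) +
          U * ∑ t ∈ Finset.range T, (∑ h, stepSize z (t + 1) h) ^ 2 := by
        rw [Finset.sum_add_distrib, ← Finset.mul_sum,
          Finset.sum_range_sub (fun t => G.eu u (f (t + 1)))]
    _ ≤ 2 * U + U * (K * (K * 2)) := by
        have h1 := abs_le.1 ((hFP.profile (T + 1) (by omega)).abs_eu_le hPR u)
        have h2 := abs_le.1 ((hFP.profile 1 le_rfl).abs_eu_le hPR u)
        linarith [mul_le_mul_of_nonneg_left hsq hU, h1.2, h2.1]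

lemma visitCount_eq_count (z : ℕ → G.Node) (h : G.Info) (t : ℕ) :
    G.visitCount z t h = Nat.count (fun t => 1 ≤ t ∧ G.visits h (z t)) (t + 1) := by
  induction t with
  | zero => simp [visitCount, Nat.count_succ]
  | succ t ih =>
    rw [visitCount_succ, ih, Nat.count_succ _ (t + 1)]
    simp [visitInd]

lemma stepSize_nth (z : ℕ → G.Node) {h : G.Info}
    (hinf : {t : ℕ | 1 ≤ t ∧ G.visits h (z t)}.Infinite) (k : ℕ) :
    stepSize z (Nat.nth (fun t => 1 ≤ t ∧ G.visits h (z t)) k) h = 1 / (k + 1 : ℝ) := by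
  have hmem := Nat.nth_mem_of_infinite hinf k
  rw [stepSize, visitCount_eq_count, Nat.count_succ, Nat.count_nth_of_infinite hinf,
    if_pos hmem, visitInd, if_pos hmem.2]
  push_cast
  rfl

end ExtGame

/-- Along any play path of fictitious play in a game with identical
interests, for every information set `h` visited infinitely often,
`Σ_k V_{f_{t_k(h)}}(h)/k < ∞`, where `t_k(h)` is the round of the `k`-th visit to `h`
(here `Nat.nth p k` is the `(k+1)`-st round at which `h` is visited). -/
theorem fp_gap_weighted_summable (G : ExtGame)
    (u : G.Node → ℝ) (hPR : G.PerfectRecall)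
    (f : ℕ → G.Info → G.Move → ℝ) (z : ℕ → G.Node)
    (hFP : G.IsFP (fun _ => u) f z)
    (h : G.Info)
    (hinf : {t : ℕ | 1 ≤ t ∧ G.visits h (z t)}.Infinite) :
    Summable fun k : ℕ =>
      G.gap u (f (Nat.nth (fun t => 1 ≤ t ∧ G.visits h (z t)) k)) h / (k + 1 : ℝ) := by
  refine ((hFP.summable_stepSize_mul_gap hPR h).comp_injective
    (Nat.nth_injective hinf)).congr fun k => ?_
  rw [Function.comp_apply, stepSize_nth z hinf, one_div_mul_eq_div]
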